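/- Proposition 1 (first claim, σ-algebra ℋ_t): Fix t ≥ 0 and let A : Ω → [0,∞) be ℋ_t-measurable. Then there exists a 𝒟⊗𝒟-measurable function H : D×D → [0,∞) such that A(ω) = H(X_·(ω), Z_·(ω)) for P-a.s. ω, and such that for P-a.s. ω̃ ∈ Ω held fixed, the map ω ↦ H(X_·(ω̃), Z_·(ω)) is ℱ^Z_t-measurable. -/

import Mathlib

open MeasureTheory Filter Topology Set
open scoped NNReal ENNReal

noncomputable section

/-- A real-valued function on `ℝ≥0` is càdlàg: right-continuous with left limits. -/
def IsCadlag (u : ℝ≥0 → ℝ) : Prop :=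
  (∀ t : ℝ≥0, ContinuousWithinAt u (Set.Ici t) t) ∧
  (∀ t : ℝ≥0, 0 < t → ∃ l : ℝ, Tendsto u (𝓝[<] t) (𝓝 l))

/-- `D`, the space of real-valued càdlàg functions on `ℝ≥0`. -/
def D : Type := {u : ℝ≥0 → ℝ // IsCadlag u}

/-- The σ-algebra `𝒟` on `D` generated by the evaluation maps `u ↦ u s`. -/
instance : MeasurableSpace D :=
  ⨆ s : ℝ≥0, MeasurableSpace.comap (fun u : D => u.1 s) inferInstance

variable {Ω : Type*} {E : Type*}

/-- The σ-algebra generated by the `μ`-null sets (used for the augmentation `·^P`). -/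
def nullSets [MeasurableSpace Ω] (μ : Measure Ω) : MeasurableSpace Ω :=
  MeasurableSpace.generateFrom {s : Set Ω | μ s = 0}

/-- The raw canonical filtration `σ(Y_s : s ≤ t)` of a process `Y`. -/
def natF [MeasurableSpace E] (Y : ℝ≥0 → Ω → E) (t : ℝ≥0) : MeasurableSpace Ω :=
  ⨆ s ∈ Set.Iic t, MeasurableSpace.comap (Y s) inferInstance

/-- `ℱ^Y_t`: the right-continuous `P`-completed canonical filtration of `Y`. -/
def rcF [MeasurableSpace Ω] [MeasurableSpace E] (μ : Measure Ω) (Y : ℝ≥0 → Ω → E)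
    (t : ℝ≥0) : MeasurableSpace Ω :=
  ⨅ u ∈ Set.Ioi t, (natF Y u ⊔ nullSets μ)

/-- `ℱ^Y_∞ := σ(⋃ t, ℱ^Y_t)`. -/
def rcFinf [MeasurableSpace Ω] [MeasurableSpace E] (μ : Measure Ω) (Y : ℝ≥0 → Ω → E) :
    MeasurableSpace Ω :=
  ⨆ t : ℝ≥0, rcF μ Y t

/-- The σ-algebra generated by the whole process `Y`. -/
def sigmaProc [MeasurableSpace E] (Y : ℝ≥0 → Ω → E) : MeasurableSpace Ω :=
  ⨆ s : ℝ≥0, MeasurableSpace.comap (Y s) inferInstance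

/-- `ℋ_t := (ℱ^X_∞ ∨ ℱ^Z_t)^P`. -/
def Hfilt [MeasurableSpace Ω] (μ : Measure Ω) (X : ℝ≥0 → Ω → ℝ) (Z : ℝ≥0 → Ω → ℝ≥0)
    (t : ℝ≥0) : MeasurableSpace Ω :=
  (rcFinf μ X ⊔ rcF μ Z t) ⊔ nullSets μ

/-- `ℱ_t := (ℱ^{X_Z}_t ∨ ℱ^Z_t)^P`, where `(X_Z)_t ω := X (Z t ω) ω`. -/
def Ffilt [MeasurableSpace Ω] (μ : Measure Ω) (X : ℝ≥0 → Ω → ℝ) (Z : ℝ≥0 → Ω → ℝ≥0)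
    (t : ℝ≥0) : MeasurableSpace Ω :=
  (rcF μ (fun u ω => X (Z u ω) ω) t ⊔ rcF μ Z t) ⊔ nullSets μ

/-- A σ-algebra containing the `μ`-null sets is closed under `μ`-a.e. equality of sets. -/
theorem measurableSet_congr_ae {m : MeasurableSpace Ω} [MeasurableSpace Ω] {μ : Measure Ω}
    (hm : nullSets μ ≤ m) {s s' : Set Ω} (hs : MeasurableSet[m] s) (h : s =ᵐ[μ] s') :
    MeasurableSet[m] s' := by
  have null : ∀ n : Set Ω, μ n = 0 → MeasurableSet[m] n := fun n hn =>
    hm n (MeasurableSpace.measurableSet_generateFrom hn)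
  have hd := ae_eq_set.1 h
  have heq : s' = (s \ (s \ s')) ∪ (s' \ s) := by
    ext ω
    simp only [mem_union, Set.mem_sdiff]
    tauto
  rw [heq]
  exact (hs.diff (null _ hd.1)).union (null _ hd.2)

theorem nullSets_le_rcF [MeasurableSpace Ω] [MeasurableSpace E] (μ : Measure Ω)
    (Y : ℝ≥0 → Ω → E) (t : ℝ≥0) : nullSets μ ≤ rcF μ Y t :=
  le_iInf₂ fun _ _ => le_sup_right

theorem rcF_le_sigmaProc_sup [MeasurableSpace Ω] [MeasurableSpace E] (μ : Measure Ω)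
    (Y : ℝ≥0 → Ω → E) (t : ℝ≥0) : rcF μ Y t ≤ sigmaProc Y ⊔ nullSets μ :=
  (iInf₂_le (t + 1) (mem_Ioi.2 (lt_add_one t))).trans
    (sup_le_sup_right (iSup₂_le fun s _ =>
      le_iSup (fun s => MeasurableSpace.comap (Y s) inferInstance) s) _)

theorem Hfilt_le [MeasurableSpace Ω] (μ : Measure Ω) (X : ℝ≥0 → Ω → ℝ)
    (Z : ℝ≥0 → Ω → ℝ≥0) (t : ℝ≥0) : Hfilt μ X Z t ≤ sigmaProc X ⊔ rcF μ Z t := by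
  have hnull : nullSets μ ≤ sigmaProc X ⊔ rcF μ Z t :=
    (nullSets_le_rcF μ Z t).trans le_sup_right
  refine sup_le (sup_le (iSup_le fun s => ?_) le_sup_right) hnull
  exact (rcF_le_sigmaProc_sup μ X s).trans (sup_le le_sup_left hnull)

theorem exists_measurableSet_ae_eq_of_sup_nullSets {m : MeasurableSpace Ω}
    [MeasurableSpace Ω] {μ : Measure Ω} {s : Set Ω} (hs : MeasurableSet[m ⊔ nullSets μ] s) :
    ∃ s', MeasurableSet[m] s' ∧ s =ᵐ[μ] s' := by
  have hle : m ⊔ nullSets μ ≤ eventuallyMeasurableSpace m (ae μ) := by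
    refine sup_le le_eventuallyMeasurableSpace
      (MeasurableSpace.generateFrom_le fun n hn => ?_)
    exact ⟨∅, @MeasurableSet.empty _ m, ae_eq_empty.2 hn⟩
  exact hle s hs

theorem measurable_eval_D (s : ℝ≥0) : Measurable fun u : D => u.1 s :=
  measurable_iff_comap_le.2
    (le_iSup (fun s : ℝ≥0 => MeasurableSpace.comap (fun u : D => u.1 s) inferInstance) s)

theorem sigmaProc_le_comap_path (X : ℝ≥0 → Ω → ℝ) (hX : ∀ ω, IsCadlag fun s => X s ω) :
    sigmaProc X ≤ MeasurableSpace.comap (fun ω => (⟨fun s => X s ω, hX ω⟩ : D))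
      (inferInstance : MeasurableSpace D) :=
  iSup_le fun s => Measurable.comap_le (f := X s)
    ((measurable_eval_D s).comp (comap_measurable (β := D) fun ω => ⟨fun s => X s ω, hX ω⟩))

theorem sigmaProc_le_comap_path_nnreal (Z : ℝ≥0 → Ω → ℝ≥0)
    (hZ : ∀ ω, IsCadlag fun s => (Z s ω : ℝ)) :
    sigmaProc Z ≤
      MeasurableSpace.comap (fun ω => (⟨fun s => (Z s ω : ℝ), hZ ω⟩ : D))
        (inferInstance : MeasurableSpace D) := by
  refine iSup_le fun s => Measurable.comap_le (f := Z s) ?_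
  have h := (measurable_real_toNNReal.comp (measurable_eval_D s)).comp
    (comap_measurable (β := D) fun ω => ⟨fun s => (Z s ω : ℝ), hZ ω⟩)
  have hZs : (Real.toNNReal ∘ fun u : D => u.1 s) ∘
      (fun ω => (⟨fun s => (Z s ω : ℝ), hZ ω⟩ : D)) = Z s :=
    funext fun ω => Real.toNNReal_coe
  exact hZs ▸ h

/-- The sets that agree a.e. with the preimage under `(x, z)` of a measurable set almost all of
whose sections along `x` pull back under `z` to `G`-measurable sets. -/
def sectionSigma {α β : Type*} [MeasurableSpace α] [MeasurableSpace β]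
    (G : MeasurableSpace Ω) [MeasurableSpace Ω] (μ : Measure Ω) (x : Ω → α) (z : Ω → β) :
    MeasurableSpace Ω where
  MeasurableSet' B := ∃ S : Set (α × β), MeasurableSet S ∧
    B =ᵐ[μ] (fun ω => (x ω, z ω)) ⁻¹' S ∧
    ∀ᵐ ω' ∂μ, MeasurableSet[G] ((fun ω => (x ω', z ω)) ⁻¹' S)
  measurableSet_empty := ⟨∅, MeasurableSet.empty, by simp, by simp⟩
  measurableSet_compl := by
    rintro B ⟨S, hS, hB, hG⟩
    exact ⟨Sᶜ, hS.compl, hB.compl, hG.mono fun ω' h => h.compl⟩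
  measurableSet_iUnion := by
    intro f hf
    choose S hS hB hG using hf
    refine ⟨⋃ i, S i, MeasurableSet.iUnion hS, ?_, ?_⟩
    · rw [preimage_iUnion]
      exact Filter.EventuallyEq.countable_iUnion hB
    · filter_upwards [ae_all_iff.2 hG] with ω' h
      rw [preimage_iUnion]
      exact MeasurableSet.iUnion h

theorem sup_le_sectionSigma {α β : Type*} [MeasurableSpace α] [MeasurableSpace β]
    {m G : MeasurableSpace Ω} [MeasurableSpace Ω] {μ : Measure Ω} {x : Ω → α} {z : Ω → β}
    (hm : m ≤ MeasurableSpace.comap x inferInstance) (hnull : nullSets μ ≤ G)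
    (hG : G ≤ MeasurableSpace.comap z inferInstance ⊔ nullSets μ) :
    m ⊔ G ≤ sectionSigma G μ x z := by
  refine sup_le (fun B hB => ?_) fun B hB => ?_
  · obtain ⟨S, hS, rfl⟩ := hm B hB
    refine ⟨Prod.fst ⁻¹' S, measurable_fst hS, EventuallyEq.rfl, ae_of_all _ fun ω' => ?_⟩
    exact @MeasurableSet.const _ G (x ω' ∈ S)
  · obtain ⟨_, ⟨S, hS, rfl⟩, hBS⟩ := exists_measurableSet_ae_eq_of_sup_nullSets (hG B hB)
    exact ⟨Prod.snd ⁻¹' S, measurable_snd hS, hBS, ae_of_all _ fun _ =>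
      measurableSet_congr_ae hnull hB hBS⟩

theorem toReal_iSup_rat_indicator {a : ℝ} (ha : 0 ≤ a) :
    (⨆ q : ℚ, {b : ℝ | (q : ℝ) < b}.indicator (fun _ => ENNReal.ofReal q) a).toReal = a := by
  have h : ⨆ q : ℚ, {b : ℝ | (q : ℝ) < b}.indicator (fun _ => ENNReal.ofReal q) a =
      ENNReal.ofReal a := by
    refine le_antisymm (iSup_le fun q => indicator_apply_le fun h => ?_) ?_
    · exact ENNReal.ofReal_le_ofReal (le_of_lt h)
    · refine le_of_forall_lt fun c hc => ?_
      obtain ⟨q, hq0, hcq, hqa⟩ := ENNReal.lt_iff_exists_rat_btwn.1 hc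
      have hq : (q : ℝ) < a := lt_of_not_ge fun h => hqa.not_ge (ENNReal.ofReal_le_ofReal h)
      refine hcq.trans_le (le_iSup_of_le q ?_)
      rw [indicator_of_mem (show a ∈ {b : ℝ | (q : ℝ) < b} from hq)]
      exact le_rfl
  rw [h, ENNReal.toReal_ofReal ha]

/-- Functional version of `sectionSigma`: a nonnegative function measurable for it factors a.e.
through `(x, z)`, with almost all partial functions `G`-measurable. -/
theorem exists_factor_of_measurable_sectionSigma {α β : Type*} [MeasurableSpace α]
    [MeasurableSpace β] {G : MeasurableSpace Ω} [MeasurableSpace Ω] {μ : Measure Ω} {x : Ω → α}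
    {z : Ω → β} {A : Ω → ℝ} (hA0 : ∀ ω, 0 ≤ A ω)
    (hA : Measurable[sectionSigma G μ x z] A) :
    ∃ H : α × β → ℝ, Measurable H ∧ (∀ p, 0 ≤ H p) ∧ (∀ᵐ ω ∂μ, A ω = H (x ω, z ω)) ∧
      ∀ᵐ ω' ∂μ, Measurable[G] fun ω => H (x ω', z ω) := by
  choose S hS hAS hG using fun q : ℚ => hA (measurableSet_Ioi (a := (q : ℝ)))
  refine ⟨fun p => (⨆ q : ℚ, (S q).indicator (fun _ => ENNReal.ofReal q) p).toReal,
    (Measurable.iSup fun q => measurable_const.indicator (hS q)).ennreal_toReal,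
    fun _ => ENNReal.toReal_nonneg, ?_, ?_⟩
  · filter_upwards [ae_all_iff.2 fun q => (hAS q).mem_iff] with ω h
    rw [← toReal_iSup_rat_indicator (hA0 ω)]
    refine congrArg ENNReal.toReal (iSup_congr fun q => ?_)
    have hq : (q : ℝ) < A ω ↔ (x ω, z ω) ∈ S q := h q
    classical
    rw [indicator_apply, indicator_apply]
    exact if_congr hq rfl rfl
  · filter_upwards [ae_all_iff.2 hG] with ω' h
    refine Measurable.ennreal_toReal (Measurable.iSup fun q => ?_)
    exact Measurable.indicator measurable_const (h q)

/-- Proposition 1, first claim, σ-algebra `ℋ_t`. -/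
theorem stmt_1 [MeasurableSpace Ω] (μ : Measure Ω) [IsProbabilityMeasure μ] [μ.IsComplete]
    (X : ℝ≥0 → Ω → ℝ) (Z : ℝ≥0 → Ω → ℝ≥0)
    (hXmeas : ∀ s, Measurable (X s)) (hZmeas : ∀ s, Measurable (Z s))
    (hX : ∀ ω, IsCadlag fun s => X s ω)
    (hZ : ∀ ω, IsCadlag fun s => (Z s ω : ℝ))
    (hZmono : ∀ ω, Monotone fun s => Z s ω)
    (hindep : ProbabilityTheory.Indep (sigmaProc X) (sigmaProc Z) μ)
    (t : ℝ≥0) (A : Ω → ℝ) (hA0 : ∀ ω, 0 ≤ A ω)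
    (hA : Measurable[Hfilt μ X Z t] A) :
    ∃ H : D × D → ℝ, Measurable H ∧ (∀ p, 0 ≤ H p) ∧
      (∀ᵐ ω ∂μ, A ω = H (⟨fun s => X s ω, hX ω⟩, ⟨fun s => (Z s ω : ℝ), hZ ω⟩)) ∧
      (∀ᵐ ω' ∂μ, Measurable[rcF μ Z t]
        fun ω => H (⟨fun s => X s ω', hX ω'⟩, ⟨fun s => (Z s ω : ℝ), hZ ω⟩)) := by
  exact exists_factor_of_measurable_sectionSigma hA0
    (hA.mono ((Hfilt_le μ X Z t).trans (sup_le_sectionSigma (sigmaProc_le_comap_path X hX)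
      (nullSets_le_rcF μ Z t) ((rcF_le_sigmaProc_sup μ Z t).trans
        (sup_le_sup_right (sigmaProc_le_comap_path_nnreal Z hZ) _)))) le_rfl)
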